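/- For every integer m ≥ 2 and every t ∈ K, the bilinear skew-symmetric bracket on V determined on basis elements by [g_1,g_k]_t = g_{k+1} for all k ≥ 2 and [g_j,g_k]_t = t·(k−j)·(m+j−3)!·(m+k−3)! / ((m−1)!·(2m+j+k−4)!) · g_{j+k+m−1} for all j,k ≥ 2, satisfies the Jacobi identity. (It arises from the subalgebra L₁{m} of the positive part of the Witt algebra spanned by e_1, e_{m+1}, e_{m+2}, …, and it gives, for each weight m−1 ≥ 1, a true deformation of 𝔪₀ independent of the one given by the 2-family; hence there are at least two true deformations of 𝔪₀ in every positive weight.) -/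

import Mathlib

variable (K : Type*) [Field K] [CharZero K]

/-- Free `K`-module with basis `g_1, g_2, …`: index `n : ℕ` represents `g_{n+1}`. -/
abbrev V := ℕ →₀ K

/-- Structure constants of the deformed bracket `[·,·]_t` attached to `m ≥ 2`: the
value of `[g_{p+1}, g_{q+1}]_t`, so that `[g_1, g_k]_t = g_{k+1}` for `k ≥ 2` and
`[g_j, g_k]_t = t·(k-j)·(m+j-3)!·(m+k-3)!/((m-1)!·(2m+j+k-4)!) • g_{j+k+m-1}` for
`j, k ≥ 2`. -/
noncomputable def L1mc (m : ℕ) (t : K) (p q : ℕ) : V K :=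
  if p = 0 ∧ 1 ≤ q then Finsupp.single (q + 1) 1
  else if q = 0 ∧ 1 ≤ p then -Finsupp.single (p + 1) 1
  else if 1 ≤ p ∧ 1 ≤ q then
    (t * ((q : K) - (p : K)) * ((m + p - 2).factorial : K) *
        ((m + q - 2).factorial : K) /
        (((m - 1).factorial : K) * ((2 * m + p + q - 2).factorial : K))) •
      Finsupp.single (p + q + m) 1
  else 0

/-- The deformed bracket `[·,·]_t`, extended bilinearly from its values on basis
vectors. -/
noncomputable def brkt (m : ℕ) (t : K) (x y : V K) : V K :=
  x.sum fun i xi => y.sum fun j yj => (xi * yj) • L1mc K m t i j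

/-- The bracket as a bilinear map. -/
noncomputable def brktBilin (m : ℕ) (t : K) : V K →ₗ[K] V K →ₗ[K] V K :=
  Finsupp.linearCombination K fun i => Finsupp.linearCombination K fun j => L1mc K m t i j

omit [CharZero K] in
lemma brkt_eq_brktBilin (m : ℕ) (t : K) (x y : V K) :
    brkt K m t x y = brktBilin K m t x y := by
  simp only [brkt, brktBilin, Finsupp.linearCombination_apply, Finsupp.sum,
    LinearMap.sum_apply, LinearMap.smul_apply, Finset.smul_sum, smul_smul]

omit [CharZero K] in
lemma brktBilin_single_single (m : ℕ) (t : K) (i j : ℕ) :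
    brktBilin K m t (Finsupp.single i 1) (Finsupp.single j 1) = L1mc K m t i j := by
  simp [brktBilin]

lemma L1mc_skew (m : ℕ) (t : K) (p q : ℕ) : L1mc K m t p q = -L1mc K m t q p := by
  rcases p with _ | p <;> rcases q with _ | q
  · simp [L1mc]
  · simp [L1mc]
  · simp [L1mc]
  · simp only [L1mc, Nat.succ_ne_zero, false_and, if_false, Nat.le_add_left, and_self, if_true]
    rw [← neg_smul, add_comm (q + 1) (p + 1), add_right_comm (2 * m) (q + 1) (p + 1)]
    congr 1
    ring

omit [CharZero K] in
lemma L1mc_zero_zero (m : ℕ) (t : K) : L1mc K m t 0 0 = 0 := by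
  simp [L1mc]

omit [CharZero K] in
lemma L1mc_zero_succ (m : ℕ) (t : K) (q : ℕ) :
    L1mc K m t 0 (q + 1) = Finsupp.single (q + 2) 1 := by
  simp [L1mc]

/-- The structure constant of `[g_{p+2}, g_{q+2}]_t` for the parameter `m + 2`. -/
noncomputable def L1mcCoeff (m : ℕ) (t : K) (p q : ℕ) : K :=
  t * ((q : K) - p) * ((m + p + 1).factorial : K) * ((m + q + 1).factorial : K) /
    (((m + 1).factorial : K) * ((2 * m + p + q + 4).factorial : K))

omit [CharZero K] in
lemma L1mc_succ_succ (m : ℕ) (t : K) (p q : ℕ) :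
    L1mc K (m + 2) t (p + 1) (q + 1) =
      L1mcCoeff K m t p q • Finsupp.single (p + q + m + 4) 1 := by
  simp only [L1mc, Nat.succ_ne_zero, false_and, if_false, Nat.le_add_left, and_self, if_true]
  rw [show m + 2 + (p + 1) - 2 = m + p + 1 by omega, show m + 2 + (q + 1) - 2 = m + q + 1 by omega,
    show m + 2 - 1 = m + 1 by omega,
    show 2 * (m + 2) + (p + 1) + (q + 1) - 2 = 2 * m + p + q + 4 by omega,
    show p + 1 + (q + 1) + (m + 2) = p + q + m + 4 by omega, L1mcCoeff]
  push_cast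
  congr 2
  ring

variable {K} in
lemma L1mcCoeff_skew (m : ℕ) (t : K) (p q : ℕ) :
    L1mcCoeff K m t p q = -L1mcCoeff K m t q p := by
  simp only [L1mcCoeff]
  rw [add_right_comm (2 * m) p q]
  ring

variable {K} in
lemma L1mcCoeff_eq_add (m : ℕ) (t : K) (p q : ℕ) :
    L1mcCoeff K m t p q = L1mcCoeff K m t (p + 1) q + L1mcCoeff K m t p (q + 1) := by
  simp only [L1mcCoeff]
  rw [show 2 * m + (p + 1) + q + 4 = (2 * m + p + q + 4) + 1 by ring,
    show 2 * m + p + (q + 1) + 4 = (2 * m + p + q + 4) + 1 by ring,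
    show m + (p + 1) + 1 = (m + p + 1) + 1 by ring,
    show m + (q + 1) + 1 = (m + q + 1) + 1 by ring,
    Nat.factorial_succ (2 * m + p + q + 4), Nat.factorial_succ (m + p + 1),
    Nat.factorial_succ (m + q + 1)]
  have h₁ : ((m + 1).factorial : K) ≠ 0 := by exact_mod_cast Nat.factorial_ne_zero _
  have h₂ : ((2 * m + p + q + 4).factorial : K) ≠ 0 := by exact_mod_cast Nat.factorial_ne_zero _
  have h₃ : (2 * m + p + q + 5 : K) ≠ 0 := by
    exact_mod_cast Nat.succ_ne_zero (2 * m + p + q + 4)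
  push_cast
  rw [show (2 * m + p + q + 4 + 1 : K) = 2 * m + p + q + 5 by ring]
  generalize hd : (2 * m + p + q + 5 : K) = d at h₃ ⊢
  field_simp
  rw [← hd]
  ring

variable {K} in
lemma L1mcCoeff_mul (m : ℕ) (t : K) (p q r : ℕ) :
    L1mcCoeff K m t p q * L1mcCoeff K m t (p + q + m + 3) r =
      ((q : K) - p) * ((r : K) - (p + q + m + 3)) *
        (t ^ 2 * ((m + p + 1).factorial : K) * ((m + q + 1).factorial : K) *
          ((m + r + 1).factorial : K) /
          (((m + 1).factorial : K) ^ 2 * ((3 * m + (p + q + r) + 7).factorial : K))) := by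
  simp only [L1mcCoeff]
  rw [show m + (p + q + m + 3) + 1 = 2 * m + p + q + 4 by ring,
    show 2 * m + (p + q + m + 3) + r + 4 = 3 * m + (p + q + r) + 7 by ring]
  have h₁ : ((m + 1).factorial : K) ≠ 0 := by exact_mod_cast Nat.factorial_ne_zero _
  have h₂ : ((2 * m + p + q + 4).factorial : K) ≠ 0 := by exact_mod_cast Nat.factorial_ne_zero _
  have h₃ : ((3 * m + (p + q + r) + 7).factorial : K) ≠ 0 := by
    exact_mod_cast Nat.factorial_ne_zero _
  push_cast
  field_simp

variable {K} in
lemma L1mcCoeff_jacobi (m : ℕ) (t : K) (p q r : ℕ) :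
    L1mcCoeff K m t p q * L1mcCoeff K m t (p + q + m + 3) r +
      L1mcCoeff K m t q r * L1mcCoeff K m t (q + r + m + 3) p +
      L1mcCoeff K m t r p * L1mcCoeff K m t (r + p + m + 3) q = 0 := by
  rw [L1mcCoeff_mul, L1mcCoeff_mul, L1mcCoeff_mul, show q + r + p = p + q + r by ring,
    show r + p + q = p + q + r by ring]
  ring

lemma brktBilin_skew (m : ℕ) (t : K) (x y : V K) :
    brktBilin K m t x y = -brktBilin K m t y x := by
  induction x using Finsupp.induction_linear with
  | zero => simp
  | add x x' hx hx' => rw [map_add, map_add, LinearMap.add_apply, hx, hx', neg_add]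
  | single i a =>
  induction y using Finsupp.induction_linear with
  | zero => simp
  | add y y' hy hy' => rw [map_add, map_add, LinearMap.add_apply, hy, hy', neg_add]
  | single j b =>
  rw [← Finsupp.smul_single_one i a, ← Finsupp.smul_single_one j b]
  simp only [map_smul, LinearMap.smul_apply, brktBilin_single_single]
  rw [L1mc_skew, smul_neg, smul_neg, smul_comm]

/-- The cyclic sum of double brackets of basis vectors. -/
noncomputable def basisJacobiator (m : ℕ) (t : K) (i j k : ℕ) : V K :=
  brktBilin K m t (L1mc K m t i j) (Finsupp.single k 1) +
    brktBilin K m t (L1mc K m t j k) (Finsupp.single i 1) +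
    brktBilin K m t (L1mc K m t k i) (Finsupp.single j 1)

omit [CharZero K] in
lemma basisJacobiator_rotate (m : ℕ) (t : K) (i j k : ℕ) :
    basisJacobiator K m t j k i = basisJacobiator K m t i j k := by
  simp only [basisJacobiator]
  abel

lemma basisJacobiator_zero_zero (m : ℕ) (t : K) (k : ℕ) :
    basisJacobiator K m t 0 0 k = 0 := by
  simp [basisJacobiator, L1mc_zero_zero, L1mc_skew K m t k 0]

lemma basisJacobiator_zero_succ_succ (m : ℕ) (t : K) (p q : ℕ) :
    basisJacobiator K (m + 2) t 0 (p + 1) (q + 1) = 0 := by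
  rw [basisJacobiator, L1mc_skew K _ t (q + 1) 0]
  simp only [L1mc_zero_succ, L1mc_succ_succ, map_neg, map_smul, LinearMap.neg_apply,
    LinearMap.smul_apply, brktBilin_single_single]
  rw [L1mc_skew K _ t (p + q + m + 4) 0, L1mc_zero_succ, L1mcCoeff_eq_add m t p q,
    L1mcCoeff_skew m t (q + 1), show p + 1 + q + m + 4 = p + q + m + 3 + 2 by ring,
    show q + 1 + p + m + 4 = p + q + m + 3 + 2 by ring]
  module

lemma basisJacobiator_succ_succ_succ (m : ℕ) (t : K) (p q r : ℕ) :
    basisJacobiator K (m + 2) t (p + 1) (q + 1) (r + 1) = 0 := by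
  simp only [basisJacobiator, L1mc_succ_succ, map_smul, LinearMap.smul_apply,
    brktBilin_single_single, smul_smul]
  rw [show q + r + m + 3 + p + m + 4 = p + q + m + 3 + r + m + 4 by ring,
    show r + p + m + 3 + q + m + 4 = p + q + m + 3 + r + m + 4 by ring, ← add_smul, ← add_smul,
    L1mcCoeff_jacobi, zero_smul]

lemma basisJacobiator_eq_zero (m : ℕ) (t : K) (i j k : ℕ) :
    basisJacobiator K (m + 2) t i j k = 0 := by
  rcases i with _ | i <;> rcases j with _ | j <;> rcases k with _ | k
  · exact basisJacobiator_zero_zero K _ t 0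
  · exact basisJacobiator_zero_zero K _ t _
  · rw [← basisJacobiator_rotate, ← basisJacobiator_rotate, basisJacobiator_zero_zero]
  · exact basisJacobiator_zero_succ_succ K m t j k
  · rw [← basisJacobiator_rotate, basisJacobiator_zero_zero]
  · rw [← basisJacobiator_rotate, basisJacobiator_zero_succ_succ]
  · rw [← basisJacobiator_rotate, ← basisJacobiator_rotate, basisJacobiator_zero_succ_succ]
  · exact basisJacobiator_succ_succ_succ K m t i j k

lemma brktBilin_jacobi (m : ℕ) (t : K) (x y z : V K) :
    brktBilin K (m + 2) t (brktBilin K (m + 2) t x y) z +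
      brktBilin K (m + 2) t (brktBilin K (m + 2) t y z) x +
      brktBilin K (m + 2) t (brktBilin K (m + 2) t z x) y = 0 := by
  induction x using Finsupp.induction_linear with
  | zero => simp
  | add x x' hx hx' =>
    simp only [map_add, LinearMap.add_apply]
    rw [← add_zero (0 : V K)]
    nth_rw 1 [← hx]
    rw [← hx']
    abel
  | single i a =>
  induction y using Finsupp.induction_linear with
  | zero => simp
  | add y y' hy hy' =>
    simp only [map_add, LinearMap.add_apply]
    rw [← add_zero (0 : V K)]
    nth_rw 1 [← hy]
    rw [← hy']
    abel
  | single j b =>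
  induction z using Finsupp.induction_linear with
  | zero => simp
  | add z z' hz hz' =>
    simp only [map_add, LinearMap.add_apply]
    rw [← add_zero (0 : V K)]
    nth_rw 1 [← hz]
    rw [← hz']
    abel
  | single k c =>
  have h := basisJacobiator_eq_zero K m t i j k
  rw [basisJacobiator] at h
  rw [← Finsupp.smul_single_one i a, ← Finsupp.smul_single_one j b, ← Finsupp.smul_single_one k c]
  simp only [map_smul, LinearMap.smul_apply, brktBilin_single_single]
  rw [← smul_zero (a * b * c), ← h]
  module

/-- For every `m ≥ 2` and every `t`, the bilinear skew-symmetric bracket `[·,·]_t`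
satisfies the Jacobi identity. It arises from the subalgebra `L₁{m}` of the positive
part of the Witt algebra, and gives for each weight `m - 1 ≥ 1` a true deformation of
`𝔪₀` independent of the 2-family; hence there are at least two true deformations of
`𝔪₀` in every positive weight. -/
theorem m0_positive_weight_deformation (m : ℕ) (hm : 2 ≤ m) (t : K) :
    (∀ x y : V K, brkt K m t x y = -brkt K m t y x) ∧
    (∀ x y z : V K,
      brkt K m t (brkt K m t x y) z + brkt K m t (brkt K m t y z) x +
        brkt K m t (brkt K m t z x) y = 0) := by
  obtain ⟨m, rfl⟩ := Nat.exists_eq_add_of_le' hm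
  simp only [brkt_eq_brktBilin]
  exact ⟨brktBilin_skew K _ t, brktBilin_jacobi K m t⟩
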